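/- Let C ≤ Mat_{n×m}(F_q) be a rank-metric code with associated rank function ρ_C(J) = dim C − dim C(J^⊥) on subspaces J of E = F_q^n. For every integer 0 ≤ r ≤ dim C and every subspace W ≤ E, the number of r-dimensional subcodes D with Supp(D) = W equals Σ_{J ≤ W} μ(J,W) · [ρ_C(E) − ρ_C(J^⊥) choose r]_q, where μ(J,W) = (−1)^(dim W − dim J) q^((dim W − dim J) choose 2). -/

import Mathlib

set_option linter.unusedSectionVars false

open Finset Matrix

variable {F : Type} [Field F] [Fintype F]

/-- The column space of a matrix: the span of its columns. -/
noncomputable def colspace {n m : ℕ} (M : Matrix (Fin n) (Fin m) F) :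
    Submodule F (Fin n → F) :=
  Submodule.span F (Set.range Mᵀ)

lemma col_mem_colspace {n m : ℕ} (M : Matrix (Fin n) (Fin m) F) (j : Fin m) :
    Mᵀ j ∈ colspace M :=
  Submodule.subset_span ⟨j, rfl⟩

/-- `codeSub C J = C(J) = { M ∈ C : colspace M ≤ J }`, as a submodule. -/
noncomputable def codeSub {n m : ℕ} (C : Submodule F (Matrix (Fin n) (Fin m) F))
    (J : Submodule F (Fin n → F)) : Submodule F (Matrix (Fin n) (Fin m) F) where
  carrier := {M | M ∈ C ∧ colspace M ≤ J}
  zero_mem' := ⟨C.zero_mem, by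
    rw [colspace]
    refine Submodule.span_le.2 ?_
    rintro _ ⟨j, rfl⟩
    have h : (0 : Matrix (Fin n) (Fin m) F)ᵀ j = 0 := by
      funext i; simp
    rw [h]; exact J.zero_mem⟩
  add_mem' := by
    rintro A B ⟨hA, hA'⟩ ⟨hB, hB'⟩
    refine ⟨C.add_mem hA hB, ?_⟩
    rw [colspace]
    refine Submodule.span_le.2 ?_
    rintro _ ⟨j, rfl⟩
    have h : (A + B)ᵀ j = Aᵀ j + Bᵀ j := by
      funext i; simp [Matrix.transpose_apply]
    rw [h]
    exact J.add_mem (hA' (col_mem_colspace A j)) (hB' (col_mem_colspace B j))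
  smul_mem' := by
    rintro c A ⟨hA, hA'⟩
    refine ⟨C.smul_mem c hA, ?_⟩
    rw [colspace]
    refine Submodule.span_le.2 ?_
    rintro _ ⟨j, rfl⟩
    have h : (c • A)ᵀ j = c • (Aᵀ j) := by
      funext i; simp [Matrix.transpose_apply]
    rw [h]
    exact J.smul_mem c (hA' (col_mem_colspace A j))

/-- Higher rank-support of a subcode: the sum of the column spaces of its members. -/
noncomputable def Supp {n m : ℕ} (D : Submodule F (Matrix (Fin n) (Fin m) F)) :
    Submodule F (Fin n → F) :=
  ⨆ M ∈ (D : Set (Matrix (Fin n) (Fin m) F)), colspace M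

/-- The linear functional `x ↦ ∑ i, x i * y i` (standard inner product with `y`). -/
noncomputable def dotForm {n : ℕ} (y : Fin n → F) : (Fin n → F) →ₗ[F] F where
  toFun x := ∑ i, x i * y i
  map_add' a b := by simp [add_mul, Finset.sum_add_distrib]
  map_smul' c a := by simp [Finset.mul_sum, mul_assoc]

/-- Orthogonal complement w.r.t. the standard inner product on `F^n`. -/
noncomputable def perp {n : ℕ} (J : Submodule F (Fin n → F)) : Submodule F (Fin n → F) :=
  ⨅ y ∈ (J : Set (Fin n → F)), LinearMap.ker (dotForm y)

/-- The linear functional `N ↦ Tr (M Nᵀ)`. -/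
noncomputable def traceForm {n m : ℕ} (M : Matrix (Fin n) (Fin m) F) :
    Matrix (Fin n) (Fin m) F →ₗ[F] F where
  toFun N := Matrix.trace (M * Nᵀ)
  map_add' A B := by simp [Matrix.transpose_add, Matrix.mul_add]
  map_smul' c A := by simp [Matrix.transpose_smul, Matrix.mul_smul]

/-- The trace dual code. -/
noncomputable def dualCode {n m : ℕ} (C : Submodule F (Matrix (Fin n) (Fin m) F)) :
    Submodule F (Matrix (Fin n) (Fin m) F) :=
  ⨅ M ∈ (C : Set (Matrix (Fin n) (Fin m) F)), LinearMap.ker (traceForm M)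

/-- Gaussian binomial coefficient `[a choose r]_q` as a rational number. -/
noncomputable def gb (q : ℚ) (a r : ℕ) : ℚ :=
  ∏ i ∈ Finset.range r, (q ^ a - q ^ i) / (q ^ r - q ^ i)

/-- Gaussian binomial with integer upper argument:
`[a choose b]_q = ∏_{i=0}^{b-1} (q^{a-i}-1)/(q^{b-i}-1)`. -/
noncomputable def gbZ (q : ℚ) (a : ℤ) (b : ℕ) : ℚ :=
  ∏ i ∈ Finset.range b, (q ^ (a - (i : ℤ)) - 1) / (q ^ ((b : ℤ) - (i : ℤ)) - 1)

/-- The rank function `ρ_C(J) = dim C − dim C(J^⊥)` associated with a rank-metric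
code `C`. -/
noncomputable def rhoC {n m : ℕ} (C : Submodule F (Matrix (Fin n) (Fin m) F))
    (J : Submodule F (Fin n → F)) : ℕ :=
  Module.finrank F C - Module.finrank F (codeSub C (perp J))

lemma gb_zero_right (q : ℚ) (a : ℕ) : gb q a 0 = 1 := by
  simp [gb]

lemma gb_eq_zero_of_lt (q : ℚ) {a r : ℕ} (h : a < r) : gb q a r = 0 :=
  Finset.prod_eq_zero (Finset.mem_range.2 h) (by simp)

lemma gb_succ_succ (q : ℚ) (hq : q ≠ 0) (a r : ℕ) :
    gb q (a + 1) (r + 1) = gb q a r * ((q ^ (a + 1) - 1) / (q ^ (r + 1) - 1)) := by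
  rw [gb, Finset.prod_range_succ', gb]
  congr 1
  · refine Finset.prod_congr rfl fun i _ => ?_
    rw [pow_succ, pow_succ, pow_succ, ← sub_mul, ← sub_mul, mul_div_mul_right _ _ hq]
  · simp

lemma gb_succ_right {q : ℚ} (hq : 1 < q) (a r : ℕ) :
    gb q a (r + 1) = gb q a r * ((q ^ a - q ^ r) / (q ^ r * (q ^ (r + 1) - 1))) := by
  have hq0 : q ≠ 0 := by positivity
  have hr : q ^ (r + 1) - 1 ≠ 0 := (sub_pos.2 (one_lt_pow₀ hq r.succ_ne_zero)).ne'
  have hden : ∏ i ∈ Finset.range (r + 1), (q ^ (r + 1) - q ^ i)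
      = (∏ i ∈ Finset.range r, (q ^ r - q ^ i)) * (q ^ r * (q ^ (r + 1) - 1)) := by
    rw [Finset.prod_range_succ', ← mul_assoc]
    congr 1
    · simp_rw [pow_succ, ← sub_mul]
      rw [Finset.prod_mul_distrib]
      simp
    · simp
  rw [gb, gb, Finset.prod_div_distrib, Finset.prod_div_distrib, hden, Finset.prod_range_succ,
    mul_div_mul_comm]

/-- The `q`-Pascal identity. -/
lemma gb_pascal {q : ℚ} (hq : 1 < q) {a r : ℕ} (h : r ≤ a) :
    gb q (a + 1) (r + 1) = gb q a (r + 1) + q ^ (a - r) * gb q a r := by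
  have hq0 : q ≠ 0 := by positivity
  have hr : q ^ (r + 1) - 1 ≠ 0 := (sub_pos.2 (one_lt_pow₀ hq r.succ_ne_zero)).ne'
  rw [gb_succ_succ q hq0, gb_succ_right hq]
  obtain ⟨k, rfl⟩ := Nat.exists_eq_add_of_le h
  rw [Nat.add_sub_cancel_left]
  field_simp
  ring

lemma sum_gb_alternating {q : ℚ} (hq : 1 < q) (d : ℕ) :
    ∑ j ∈ Finset.range (d + 1), (-1) ^ (d - j) * q ^ ((d - j).choose 2) * gb q d j
      = if d = 0 then 1 else 0 := by
  obtain _ | d := d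
  · simp [gb]
  let A : ℕ → ℚ := fun j => (-1) ^ (d + 1 - j) * q ^ ((d + 1 - j).choose 2) * gb q d j
  have hstep : ∀ j ∈ Finset.range (d + 1),
      (-1) ^ (d + 1 - (j + 1)) * q ^ ((d + 1 - (j + 1)).choose 2) * gb q (d + 1) (j + 1)
        = A (j + 1) - A j := by
    intro j hj
    have hj : j ≤ d := Nat.lt_succ_iff.1 (Finset.mem_range.1 hj)
    simp only [A, gb_pascal hq hj, Nat.add_sub_add_right, Nat.succ_sub hj,
      Nat.succ_eq_add_one, Nat.choose_succ_succ' _ 1, Nat.choose_one_right, pow_succ, pow_add]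
    ring
  rw [Finset.sum_range_succ', Finset.sum_congr rfl hstep, Finset.sum_range_sub]
  simp [A, gb_zero_right, gb_eq_zero_of_lt]

/-- A linearly independent `r`-tuple is the same as an `r`-dimensional subspace together with a
linearly independent `r`-tuple in it. -/
noncomputable def sigmaLinearIndependentEquiv (K V : Type*) [Field K] [AddCommGroup V] [Module K V]
    [Module.Finite K V] (r : ℕ) :
    (Σ D : {D : Submodule K V // Module.finrank K D = r},
      {t : Fin r → D.1 // LinearIndependent K t}) ≃
      {s : Fin r → V // LinearIndependent K s} :=
  Equiv.ofBijective
    (fun x => ⟨fun i => x.2.1 i, x.2.2.map' x.1.1.subtype (Submodule.ker_subtype _)⟩) <| by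
    constructor
    · have hspan : ∀ (D : Submodule K V), Module.finrank K D = r → ∀ t : Fin r → D,
          LinearIndependent K t → Submodule.span K (Set.range fun i => (t i : V)) = D := by
        intro D hD t ht
        refine Submodule.eq_of_le_of_finrank_eq (Submodule.span_le.2 ?_) ?_
        · rintro _ ⟨i, rfl⟩
          exact (t i).2
        · rw [hD]
          exact (finrank_span_eq_card (ht.map' D.subtype (Submodule.ker_subtype _))).trans
            (Fintype.card_fin r)
      rintro ⟨⟨D, hD⟩, t, ht⟩ ⟨⟨D', hD'⟩, t', ht'⟩ h
      have h : (fun i => (t i : V)) = fun i => (t' i : V) := congrArg Subtype.val h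
      obtain rfl : D = D' := by rw [← hspan D hD t ht, h, hspan D' hD' t' ht']
      obtain rfl : t = t' := funext fun i => Subtype.ext (congrFun h i)
      rfl
    · rintro ⟨s, hs⟩
      exact ⟨⟨⟨Submodule.span K (Set.range s), by simp [finrank_span_eq_card hs]⟩,
        ⟨fun i => ⟨s i, Submodule.subset_span ⟨i, rfl⟩⟩, linearIndependent_span hs⟩⟩, rfl⟩

/-- The number of `r`-dimensional subspaces is a Gaussian binomial coefficient. -/
lemma card_submodule_finrank_eq (K V : Type*) [Field K] [Fintype K] [AddCommGroup V] [Module K V]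
    [Finite V] (r : ℕ) :
    (Nat.card {D : Submodule K V // Module.finrank K D = r} : ℚ)
      = gb (Fintype.card K) (Module.finrank K V) r := by
  have hq : (1 : ℕ) < Fintype.card K := Fintype.one_lt_card
  by_cases hr : r ≤ Module.finrank K V
  · have hcard := Nat.card_congr (sigmaLinearIndependentEquiv K V r)
    have := Fintype.ofFinite {D : Submodule K V // Module.finrank K D = r}
    have hfib (D : {D : Submodule K V // Module.finrank K D = r}) :
        Nat.card {t : Fin r → D.1 // LinearIndependent K t}
          = ∏ i : Fin r, (Fintype.card K ^ r - Fintype.card K ^ (i : ℕ)) := by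
      rw [card_linearIndependent D.2.ge, D.2]
    rw [Nat.card_sigma, card_linearIndependent hr, Finset.sum_congr rfl fun D _ => hfib D,
      Finset.sum_const, Finset.card_univ, ← Nat.card_eq_fintype_card, smul_eq_mul] at hcard
    have hcast (a : ℕ) (ha : r ≤ a) :
        ((∏ i : Fin r, (Fintype.card K ^ a - Fintype.card K ^ (i : ℕ)) : ℕ) : ℚ)
          = ∏ i ∈ Finset.range r, ((Fintype.card K : ℚ) ^ a - (Fintype.card K : ℚ) ^ i) := by
      rw [Fin.prod_univ_eq_prod_range
        (fun i => Fintype.card K ^ a - Fintype.card K ^ i), Nat.cast_prod]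
      refine Finset.prod_congr rfl fun i hi => ?_
      rw [Nat.cast_sub (Nat.pow_le_pow_right hq.le ((Finset.mem_range.1 hi).le.trans ha))]
      simp
    rw [gb, Finset.prod_div_distrib, ← hcast _ hr, ← hcast _ le_rfl, ← hcard, Nat.cast_mul,
      mul_div_cancel_right₀]
    rw [Nat.cast_ne_zero, Finset.prod_ne_zero_iff]
    exact fun i _ => (Nat.sub_pos_of_lt (Nat.pow_lt_pow_right hq i.2)).ne'
  · rw [gb_eq_zero_of_lt _ (not_le.1 hr), Nat.cast_eq_zero]
    have : IsEmpty {D : Submodule K V // Module.finrank K D = r} :=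
      ⟨fun D => hr (D.2 ▸ Submodule.finrank_le D.1)⟩
    exact Nat.card_of_isEmpty

/-- The sum of `μ(J, V)` over all subspaces `J ≤ V`. -/
lemma sum_moebius (K V : Type*) [Field K] [Fintype K] [AddCommGroup V] [Module K V]
    [Finite V] [Fintype (Submodule K V)] :
    ∑ J : Submodule K V, (-1 : ℚ) ^ (Module.finrank K V - Module.finrank K J) *
        (Fintype.card K : ℚ) ^ ((Module.finrank K V - Module.finrank K J).choose 2)
      = if Module.finrank K V = 0 then 1 else 0 := by
  classical
  have hq : (1 : ℚ) < Fintype.card K := by exact_mod_cast Fintype.one_lt_card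
  rw [← sum_gb_alternating hq, ← Finset.sum_fiberwise_of_maps_to
    (t := Finset.range (Module.finrank K V + 1)) (g := fun J : Submodule K V => Module.finrank K J)
    fun J _ => Finset.mem_range_succ_iff.2 (Submodule.finrank_le J)]
  refine Finset.sum_congr rfl fun j _ => ?_
  rw [← card_submodule_finrank_eq K V j, Nat.card_eq_fintype_card, Fintype.card_subtype,
    Finset.sum_congr rfl (g := fun _ => (-1 : ℚ) ^ (Module.finrank K V - j) *
      (Fintype.card K : ℚ) ^ ((Module.finrank K V - j).choose 2)) (fun J hJ => by
        rw [(Finset.mem_filter.1 hJ).2]), Finset.sum_const, nsmul_eq_mul, mul_comm]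

/-- The dimension of the preimage of a subspace of a quotient. -/
lemma finrank_comap_mkQ {K V : Type*} [Field K] [AddCommGroup V] [Module K V]
    [Module.Finite K V] (U : Submodule K V) (J : Submodule K (V ⧸ U)) :
    Module.finrank K (J.comap U.mkQ) = Module.finrank K J + Module.finrank K U := by
  have hiso := (Submodule.quotientQuotientEquivQuotient U (J.comap U.mkQ)
    (Submodule.le_comap_mkQ U J)).finrank_eq
  rw [Submodule.map_comap_eq_of_surjective U.mkQ_surjective] at hiso
  have hP := (J.comap U.mkQ).finrank_quotient_add_finrank
  have hJ := J.finrank_quotient_add_finrank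
  have hU := U.finrank_quotient_add_finrank
  lia

/-- The sum of `μ(J, W)` over the interval `[U, W]`. -/
lemma sum_moebius_Icc {K V : Type*} [Field K] [Fintype K] [AddCommGroup V] [Module K V]
    [Finite V] [Fintype (Submodule K V)] [DecidableEq (Submodule K V)]
    [DecidableLE (Submodule K V)] {U W : Submodule K V} (hUW : U ≤ W) :
    ∑ J : Submodule K V with U ≤ J ∧ J ≤ W,
      (-1 : ℚ) ^ (Module.finrank K W - Module.finrank K J) *
        (Fintype.card K : ℚ) ^ ((Module.finrank K W - Module.finrank K J).choose 2)
      = if U = W then 1 else 0 := by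
  let U' := U.submoduleOf W
  have : Finite (W ⧸ U') := Module.finite_of_finite K
  have : Fintype (Submodule K (W ⧸ U')) :=
    @Fintype.ofFinite _ (Finite.of_injective _ SetLike.coe_injective)
  have hU : Module.finrank K U' = Module.finrank K U :=
    (Submodule.submoduleOfEquivOfLe hUW).finrank_eq
  have hquot : Module.finrank K (W ⧸ U') + Module.finrank K U' = Module.finrank K W :=
    U'.finrank_quotient_add_finrank
  have hmap : U'.map W.subtype = U :=
    (Submodule.map_comap_subtype W U).trans (inf_eq_right.2 hUW)
  have hEq : U = W ↔ Module.finrank K (W ⧸ U') = 0 :=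
    ⟨fun h => by rw [h] at hU; lia, fun h => Submodule.eq_of_le_of_finrank_eq hUW (by lia)⟩
  simp only [hEq, ← sum_moebius K (W ⧸ U')]
  symm
  refine Finset.sum_bij (fun J _ => (J.comap U'.mkQ).map W.subtype) (fun J _ => ?_)
    (fun J _ J' _ h => ?_) (fun J hJ => ?_) (fun J _ => ?_)
  · rw [Finset.mem_filter_univ]
    exact ⟨hmap.ge.trans (Submodule.map_mono (Submodule.le_comap_mkQ U' J)),
      Submodule.map_subtype_le W _⟩
  · exact Submodule.comap_injective_of_surjective U'.mkQ_surjective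
      (Submodule.map_injective_of_injective W.subtype_injective h)
  · obtain ⟨hUJ, hJW⟩ := (Finset.mem_filter_univ _).1 hJ
    refine ⟨(J.comap W.subtype).map U'.mkQ, Finset.mem_univ _, ?_⟩
    have hle : U' ≤ J.comap W.subtype := Submodule.comap_mono hUJ
    rw [Submodule.comap_map_mkQ, sup_eq_right.2 hle, Submodule.map_comap_subtype,
      inf_eq_right.2 hJW]
  · rw [Submodule.finrank_map_subtype_eq, finrank_comap_mkQ, ← hquot, Nat.add_sub_add_right]

lemma perp_perp {n : ℕ} (J : Submodule F (Fin n → F)) : perp (perp J) = J := by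
  have hperp (J : Submodule F (Fin n → F)) :
      perp J = LinearMap.BilinForm.orthogonal (dotProductBilin F F) J := by
    ext x
    simp [perp, dotForm, dotProductBilin, LinearMap.BilinForm.mem_orthogonal_iff, dotProduct,
      mul_comm]
  rw [hperp, hperp, LinearMap.BilinForm.orthogonal_orthogonal]
  · exact ⟨fun x h => dotProduct_eq_zero x h,
      fun x h => dotProduct_eq_zero x fun w => (dotProduct_comm x w).trans (h w)⟩
  · intro x y h
    simpa [dotProduct_comm] using h

lemma codeSub_le {n m : ℕ} (C : Submodule F (Matrix (Fin n) (Fin m) F))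
    (J : Submodule F (Fin n → F)) : codeSub C J ≤ C :=
  fun _ hM => hM.1

lemma le_codeSub_iff {n m : ℕ} {C D : Submodule F (Matrix (Fin n) (Fin m) F)}
    {J : Submodule F (Fin n → F)} : D ≤ codeSub C J ↔ D ≤ C ∧ Supp D ≤ J := by
  rw [Supp, iSup₂_le_iff]
  exact ⟨fun h => ⟨fun M hM => (h hM).1, fun M hM => (h hM).2⟩,
    fun h M hM => ⟨h.1 hM, h.2 M hM⟩⟩

lemma perp_top {n : ℕ} : perp (⊤ : Submodule F (Fin n → F)) = ⊥ := by
  rw [← perp_perp ⊥, perp]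
  congr 1
  simp [perp, dotForm]

lemma codeSub_bot {n m : ℕ} (C : Submodule F (Matrix (Fin n) (Fin m) F)) :
    codeSub C ⊥ = ⊥ := by
  refine (Submodule.eq_bot_iff _).2 fun M hM => ?_
  ext i j
  exact congrFun ((Submodule.mem_bot F).1 (hM.2 (col_mem_colspace M j))) i

/-- `ρ_C(E) − ρ_C(J^⊥) = dim C(J)`. -/
lemma rhoC_top_sub_rhoC_perp {n m : ℕ} (C : Submodule F (Matrix (Fin n) (Fin m) F))
    (J : Submodule F (Fin n → F)) :
    rhoC C ⊤ - rhoC C (perp J) = Module.finrank F (codeSub C J) := by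
  have := Submodule.finrank_mono (codeSub_le C J)
  rw [rhoC, rhoC, perp_perp, perp_top, codeSub_bot, finrank_bot]
  lia

/-- The number of `r`-dimensional subspaces of a given subspace. -/
lemma card_le_and_finrank_eq {K V : Type*} [Field K] [Fintype K] [AddCommGroup V] [Module K V]
    [Finite V] (C : Submodule K V) (r : ℕ) :
    (Nat.card {D : Submodule K V // D ≤ C ∧ Module.finrank K D = r} : ℚ)
      = gb (Fintype.card K) (Module.finrank K C) r := by
  rw [← card_submodule_finrank_eq K C r, Nat.cast_inj]
  refine (Nat.card_congr ?_).symm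
  let e : Submodule K C ≃ {D : Submodule K V // D ≤ C} := C.mapIic.toEquiv
  refine (e.subtypeEquiv (q := fun D => Module.finrank K D.1 = r)
    fun D => ?_).trans (Equiv.subtypeSubtypeEquivSubtypeInter (· ≤ C)
      (fun D => Module.finrank K D = r))
  exact (Submodule.finrank_map_subtype_eq C D).symm ▸ Iff.rfl

/-- The `r`-th higher support distribution via Möbius inversion:
`A^(r)_C(W) = ∑_{J ≤ W} μ(J,W) [ρ_C(E) − ρ_C(J^⊥) choose r]_q`. -/
theorem higher_support_distribution_formula (n m : ℕ)
    (C : Submodule F (Matrix (Fin n) (Fin m) F))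
    (r : ℕ) (hr : r ≤ Module.finrank F C) (W : Submodule F (Fin n → F)) :
    (Nat.card {D : Submodule F (Matrix (Fin n) (Fin m) F) //
        D ≤ C ∧ Module.finrank F D = r ∧ Supp D = W} : ℚ)
      = ∑ᶠ J ∈ {J : Submodule F (Fin n → F) | J ≤ W},
          (-1 : ℚ) ^ (Module.finrank F W - Module.finrank F J) *
            (Fintype.card F : ℚ) ^ ((Module.finrank F W - Module.finrank F J).choose 2) *
            gb (Fintype.card F)
              (rhoC C (⊤ : Submodule F (Fin n → F)) - rhoC C (perp J)) r := by
  classical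
  have : Finite (Submodule F (Fin n → F)) := Finite.of_injective _ SetLike.coe_injective
  have : Finite (Submodule F (Matrix (Fin n) (Fin m) F)) :=
    Finite.of_injective _ SetLike.coe_injective
  have := Fintype.ofFinite (Submodule F (Fin n → F))
  have := Fintype.ofFinite (Submodule F (Matrix (Fin n) (Fin m) F))
  let S : Finset (Submodule F (Matrix (Fin n) (Fin m) F)) :=
    {D | D ≤ C ∧ Module.finrank F D = r}
  have hgb (J : Submodule F (Fin n → F)) :
      gb (Fintype.card F) (rhoC C ⊤ - rhoC C (perp J)) r
        = ∑ D ∈ S, if Supp D ≤ J then 1 else 0 := by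
    rw [rhoC_top_sub_rhoC_perp, ← card_le_and_finrank_eq, Nat.card_eq_fintype_card,
      Fintype.card_subtype, Finset.sum_boole, Finset.filter_filter]
    simp only [le_codeSub_iff, and_right_comm]
  have hinner (D : Submodule F (Matrix (Fin n) (Fin m) F)) :
      ∑ J : Submodule F (Fin n → F) with J ≤ W,
        (-1 : ℚ) ^ (Module.finrank F W - Module.finrank F J) *
          (Fintype.card F : ℚ) ^ ((Module.finrank F W - Module.finrank F J).choose 2) *
          (if Supp D ≤ J then 1 else 0) = if Supp D = W then 1 else 0 := by
    simp only [mul_ite, mul_one, mul_zero]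
    rw [← Finset.sum_filter, Finset.filter_filter]
    simp only [and_comm (b := Supp D ≤ _)]
    by_cases h : Supp D ≤ W
    · exact sum_moebius_Icc h
    · rw [if_neg fun h' => h h'.le]
      exact Finset.sum_eq_zero fun J hJ =>
        absurd ((Finset.mem_filter_univ _).1 hJ) fun hJ => h (hJ.1.trans hJ.2)
  rw [finsum_mem_eq_toFinset_sum, Set.toFinset_ofPred]
  simp only [hgb, Finset.mul_sum]
  rw [Finset.sum_comm]
  simp only [hinner]
  rw [Finset.sum_boole, Finset.filter_filter, Nat.card_eq_fintype_card, Fintype.card_subtype]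
  simp only [and_assoc]
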